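/- arXiv:2412.17742 — 2 statements merged into one kernel-verified Lean document; each statement's English description precedes it below -/
import Mathlib

section
/- (Blocked loop Hafnian master theorem.) Let M ≥ 1, let A ∈ ℂ^{2M×2M} be symmetric, let γ ∈ ℂ^{2M}, let Λ = {Λ_1,…,Λ_L} be a set partition of {1,…,M}, and let w ∈ ℂ^L. Define z̄ ∈ ℂ^M by z̄_i = w_j whenever i ∈ Λ_j. Then for every N ∈ ℕ, Σ_{b ∈ ℕ^L, b_1+⋯+b_L = N} lhaf_Λ(A, γ, b) · Π_{j=1}^L w_j^{b_j}/b_j! = f_N(A, γ, z̄). -/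
open Matrix

noncomputable section

/-- The loop Hafnian of a matrix `B`: the sum over all involutions `σ` of `{0,…,d-1}`
of the product over `i ≤ σ i` of `B i (σ i)`. -/
def lhaf {d : ℕ} (B : Matrix (Fin d) (Fin d) ℂ) : ℂ :=
  ∑ σ ∈ Finset.univ.filter (fun σ : Equiv.Perm (Fin d) => σ * σ = 1),
    ∏ i ∈ Finset.univ.filter (fun i => i ≤ σ i), B i (σ i)

/-- `filldiag A γ` is `A` with its diagonal overwritten by the entries of `γ`. -/
def filldiag {d : ℕ} (A : Matrix (Fin d) (Fin d) ℂ) (γ : Fin d → ℂ) :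
    Matrix (Fin d) (Fin d) ℂ :=
  Matrix.of fun i j => if i = j then γ i else A i j

/-- `lhaf(A, γ) := lhaf(filldiag(A, γ))`. -/
def lhafv {d : ℕ} (A : Matrix (Fin d) (Fin d) ℂ) (γ : Fin d → ℂ) : ℂ :=
  lhaf (filldiag A γ)

/-- The list containing `n k` consecutive copies of `k`, for `k = 0, 1, …, M-1` in order. -/
def repList {M : ℕ} (n : Fin M → ℕ) : List (Fin M) :=
  (List.finRange M).flatMap fun k => List.replicate (n k) k

lemma repList_length {M : ℕ} (n : Fin M → ℕ) : (repList n).length = ∑ k, n k := by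
  simp only [repList, List.length_flatMap, Fin.sum_univ_def, List.map_map]
  congr 1
  simp [Function.comp]

/-- The repetition map sending each of the `∑ k, n k` indices to the original index of
which it is a copy (`n k` copies of `k`, in order). -/
def rep {M : ℕ} (n : Fin M → ℕ) (i : Fin (∑ k, n k)) : Fin M :=
  (repList n).get (Fin.cast (repList_length n).symm i)

/-- The doubled repetition map: the first `∑ k, n k` indices are copies of the "left"
indices (`n k` copies of `inl k`), the last `∑ k, m k` are copies of the "right" indices
(`m k` copies of `inr k`). -/
def dbl {M : ℕ} (n m : Fin M → ℕ) :
    Fin ((∑ k, n k) + (∑ k, m k)) → Fin M ⊕ Fin M :=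
  (Sum.map (rep n) (rep m)) ∘ finSumFinEquiv.symm

/-- `A_{n⊕m}`: the matrix obtained from a `2M × 2M` matrix `A` (indexed by
`Fin M ⊕ Fin M`) by taking `n k` copies of the `k`-th row/column and `m k` copies of the
`(M+k)`-th row/column. -/
def repMat {M : ℕ} (A : Matrix (Fin M ⊕ Fin M) (Fin M ⊕ Fin M) ℂ) (n m : Fin M → ℕ) :
    Matrix (Fin ((∑ k, n k) + (∑ k, m k))) (Fin ((∑ k, n k) + (∑ k, m k))) ℂ :=
  A.submatrix (dbl n m) (dbl n m)

/-- `γ_{n⊕m}`: the vector obtained from `γ` by taking `n k` copies of the `k`-th entry and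
`m k` copies of the `(M+k)`-th entry. -/
def repVec {M : ℕ} (γ : Fin M ⊕ Fin M → ℂ) (n m : Fin M → ℕ) :
    Fin ((∑ k, n k) + (∑ k, m k)) → ℂ :=
  γ ∘ dbl n m

/-- The swap matrix `X = [[0, I],[I, 0]]`. -/
def Xmat (ι : Type*) [DecidableEq ι] [Fintype ι] (R : Type*) [CommRing R] :
    Matrix (ι ⊕ ι) (ι ⊕ ι) R :=
  Matrix.fromBlocks 0 1 1 0

/-- `D(z) = diag(z) ⊕ diag(z)`. -/
def Dmat {ι : Type*} [DecidableEq ι] {R : Type*} [CommRing R] (z : ι → R) :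
    Matrix (ι ⊕ ι) (ι ⊕ ι) R :=
  Matrix.diagonal (Sum.elim z z)

/-- `g_k(A,γ,z) = tr((D(z)XA)^k)/(2k) + (1/2)·γᵀ (D(z)XA)^{k-1} D(z)X γ`. -/
def gfun {ι : Type*} [Fintype ι] [DecidableEq ι] {R : Type*} [CommRing R]
    (A : Matrix (ι ⊕ ι) (ι ⊕ ι) R) (γ : ι ⊕ ι → R) (z : ι → R) (k : ℕ) : R :=
  Ring.inverse ((2 * k : ℕ) : R) * Matrix.trace ((Dmat z * Xmat ι R * A) ^ k)
    + Ring.inverse (2 : R) *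
        (γ ⬝ᵥ Matrix.mulVec ((Dmat z * Xmat ι R * A) ^ (k - 1) * (Dmat z * Xmat ι R)) γ)

/-- `f_N(A,γ,z)`: the coefficient of `η^N` in `Σ_{j=0}^N (1/j!)(Σ_{k=1}^N g_k(A,γ,z) η^k)^j`. -/
def fN {ι : Type*} [Fintype ι] [DecidableEq ι] {R : Type*} [CommRing R]
    (N : ℕ) (A : Matrix (ι ⊕ ι) (ι ⊕ ι) R) (γ : ι ⊕ ι → R) (z : ι → R) : R :=
  Polynomial.coeff
    (∑ j ∈ Finset.range (N + 1),
      Polynomial.C (Ring.inverse ((j.factorial : ℕ) : R)) *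
        (∑ k ∈ Finset.Icc 1 N, Polynomial.C (gfun A γ z k) * Polynomial.X ^ k) ^ j) N

/-- The set `K_Λ^b` of detection patterns compatible with the coarse-grained pattern `b`,
for the set partition of `Fin M` whose blocks are the fibers of the (surjective) labeling
map `π : Fin M → Fin L`. -/
def Kset {M L : ℕ} (π : Fin M → Fin L) (b : Fin L → ℕ) : Finset (Fin M → ℕ) :=
  (Fintype.piFinset fun _ : Fin M => Finset.range ((∑ j, b j) + 1)).filter
    (fun n => ∀ j, ∑ i ∈ Finset.univ.filter (fun i => π i = j), n i = b j)

/-- The `Λ`-blocked loop Hafnian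
`lhaf_Λ(A,γ,b) := (Π_j b_j!) · Σ_{n ∈ K_Λ^b} lhaf(A_{n⊕n}, γ_{n⊕n}) / Π_i n_i!`. -/
def lhafB {M L : ℕ} (π : Fin M → Fin L)
    (A : Matrix (Fin M ⊕ Fin M) (Fin M ⊕ Fin M) ℂ) (γ : Fin M ⊕ Fin M → ℂ)
    (b : Fin L → ℕ) : ℂ :=
  (∏ j, ((b j).factorial : ℂ)) *
    ∑ n ∈ Kset π b,
      lhafv (repMat A n n) (repVec γ n n) / ∏ i, ((n i).factorial : ℂ)



section Stein
variable {κ : Type} [Fintype κ] [DecidableEq κ]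

def aop (A : Matrix κ κ ℂ) (γ : κ → ℂ) (i : κ) : Module.End ℂ (MvPolynomial κ ℂ) :=
  LinearMap.mulLeft ℂ (MvPolynomial.X i) + γ i • 1
    + ∑ j, A i j • (MvPolynomial.pderiv j).toLinearMap

theorem aop_apply (A : Matrix κ κ ℂ) (γ : κ → ℂ) (i : κ) (p : MvPolynomial κ ℂ) :
    aop A γ i p = MvPolynomial.X i * p + γ i • p + ∑ j, A i j • MvPolynomial.pderiv j p := by
  simp [aop]

theorem pderiv_comm' (i j : κ) (p : MvPolynomial κ ℂ) :
    MvPolynomial.pderiv i (MvPolynomial.pderiv j p)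
      = MvPolynomial.pderiv j (MvPolynomial.pderiv i p) := by
  induction p using MvPolynomial.induction_on with
  | C a => simp
  | add p q hp hq => simp [hp, hq]
  | mul_X p k hp =>
    simp only [Derivation.leibniz, map_add, smul_eq_mul, hp, MvPolynomial.pderiv_X]
    have h : ∀ a b : κ, MvPolynomial.pderiv a (Pi.single (M := fun _ => MvPolynomial κ ℂ) b 1 k) = 0 := by
      intro a b
      by_cases hb : k = b
      · subst hb; simp
      · simp [Pi.single_eq_of_ne hb]
    simp only [h]
    ring

theorem pderiv_aop (A : Matrix κ κ ℂ) (γ : κ → ℂ) (i j : κ) (p : MvPolynomial κ ℂ) :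
    MvPolynomial.pderiv j (aop A γ i p)
      = aop A γ i (MvPolynomial.pderiv j p) + (if i = j then 1 else 0 : ℂ) • p := by
  simp only [aop_apply, map_add, map_sum, Derivation.leibniz, MvPolynomial.pderiv_X,
    Derivation.map_smul, smul_eq_mul, pderiv_comm' j]
  by_cases h : i = j
  · subst h; simp; ring
  · simp [h, Pi.single_eq_of_ne h]

theorem aop_comm (A : Matrix κ κ ℂ) (hA : A.IsSymm) (γ : κ → ℂ) (i k : κ) :
    aop A γ i * aop A γ k = aop A γ k * aop A γ i := by
  apply LinearMap.ext
  intro p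
  simp only [Module.End.mul_apply]
  rw [aop_apply A γ i (aop A γ k p)]
  simp only [pderiv_aop]
  rw [aop_apply A γ k (aop A γ i p)]
  simp only [pderiv_aop]
  simp only [smul_add, Finset.sum_add_distrib, aop_apply, ite_smul, smul_ite, one_smul, zero_smul,
    smul_zero, Finset.sum_ite_eq, Finset.mem_univ, if_true, hA.apply i k, mul_add, Finset.mul_sum,
    Finset.smul_sum, mul_smul_comm, smul_smul]
  rw [Finset.sum_comm (f := fun x y => (A i x * A k y) • _)]
  simp only [pderiv_comm', mul_comm (A i _), mul_comm (γ i)]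
  rw [mul_left_comm (MvPolynomial.X i) (MvPolynomial.X k)]
  abel

theorem stein_exists (A : Matrix κ κ ℂ) (hA : A.IsSymm) (γ : κ → ℂ) :
    ∃ E : MvPolynomial κ ℂ →ₗ[ℂ] ℂ, E 1 = 1 ∧ ∀ i p,
      E (MvPolynomial.X i * p) = γ i * E p + ∑ j, A i j * E (MvPolynomial.pderiv j p) := by
  classical
  let S := Algebra.adjoin ℂ (Set.range (aop A γ))
  let _ : CommRing S := Algebra.adjoinCommRingOfComm ℂ (by
    rintro _ ⟨i, rfl⟩ _ ⟨k, rfl⟩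
    exact aop_comm A hA γ i k)
  let φ : MvPolynomial κ ℂ →ₐ[ℂ] S :=
    MvPolynomial.aeval (fun i => (⟨aop A γ i, Algebra.subset_adjoin ⟨i, rfl⟩⟩ : S))
  have hφX : ∀ i, ((φ (MvPolynomial.X i) : S) : Module.End ℂ (MvPolynomial κ ℂ)) = aop A γ i := by
    intro i; simp [φ]
  have hmul : ∀ p q, ((φ (p * q) : S) : Module.End ℂ (MvPolynomial κ ℂ)) = (φ p : Module.End ℂ (MvPolynomial κ ℂ)) * (φ q : Module.End ℂ (MvPolynomial κ ℂ)) := by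
    intro p q; rw [map_mul]; rfl
  have hadd : ∀ p q, ((φ (p + q) : S) : Module.End ℂ (MvPolynomial κ ℂ)) = (φ p : Module.End ℂ (MvPolynomial κ ℂ)) + (φ q : Module.End ℂ (MvPolynomial κ ℂ)) := by
    intro p q; rw [map_add]; rfl
  have hsmul : ∀ (c : ℂ) p, ((φ (c • p) : S) : Module.End ℂ (MvPolynomial κ ℂ)) = c • (φ p : Module.End ℂ (MvPolynomial κ ℂ)) := by
    intro c p; rw [map_smul]; rfl
  have hone : ((φ 1 : S) : Module.End ℂ (MvPolynomial κ ℂ)) = 1 := by rw [map_one]; rfl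
  have hder : ∀ j p r, MvPolynomial.pderiv j ((φ p : Module.End ℂ (MvPolynomial κ ℂ)) r)
      = (φ p : Module.End ℂ (MvPolynomial κ ℂ)) (MvPolynomial.pderiv j r)
        + (φ (MvPolynomial.pderiv j p) : Module.End ℂ (MvPolynomial κ ℂ)) r := by
    intro j p
    induction p using MvPolynomial.induction_on with
    | C a =>
      intro r
      have : (MvPolynomial.C a : MvPolynomial κ ℂ) = a • 1 := by
        rw [MvPolynomial.smul_eq_C_mul, mul_one]
      rw [MvPolynomial.pderiv_C, map_zero, this, hsmul, hone]
      simp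
    | add p q hp hq =>
      intro r
      rw [hadd, map_add (MvPolynomial.pderiv j) p q, hadd]
      simp only [LinearMap.add_apply, map_add, hp, hq]
      abel
    | mul_X p i hp =>
      intro r
      rw [Derivation.leibniz, hadd, smul_eq_mul, smul_eq_mul, hmul, hmul, mul_comm (MvPolynomial.X i), hmul,
        hφX]
      simp only [LinearMap.add_apply, Module.End.mul_apply, hp, pderiv_aop, map_add]
      rw [add_assoc]
      congr 2
      rw [MvPolynomial.pderiv_X]
      by_cases h : i = j
      · subst h; simp [hone]
      · have : (φ 0 : Module.End ℂ (MvPolynomial κ ℂ)) = 0 := by rw [map_zero]; rfl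
        simp [h, Pi.single_eq_of_ne h, this]
  let E : MvPolynomial κ ℂ →ₗ[ℂ] ℂ :=
    { toFun := fun p => MvPolynomial.constantCoeff ((φ p : Module.End ℂ (MvPolynomial κ ℂ)) 1)
      map_add' := by intro p q; rw [hadd]; simp
      map_smul' := by intro c p; rw [hsmul]; simp [MvPolynomial.smul_eq_C_mul] }
  have hE : ∀ p, E p = MvPolynomial.constantCoeff ((φ p : Module.End ℂ (MvPolynomial κ ℂ)) 1) := fun _ => rfl
  refine ⟨E, ?_, ?_⟩
  · rw [hE, hone]; simp
  · intro i p
    simp only [hE]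
    rw [hmul, hφX, Module.End.mul_apply, aop_apply]
    simp only [hder, MvPolynomial.pderiv_one, map_zero, zero_add]
    simp [MvPolynomial.smul_eq_C_mul]

end Stein


section Comb
variable {d : ℕ}

def hs (B : Matrix (Fin d) (Fin d) ℂ) (s : Finset (Fin d)) : ℂ :=
  ∑ σ ∈ Finset.univ.filter
      (fun σ : Equiv.Perm (Fin d) => σ * σ = 1 ∧ ∀ i, i ∉ s → σ i = i),
    ∏ i ∈ s.filter (fun i => i ≤ σ i), B i (σ i)

theorem hs_univ (B : Matrix (Fin d) (Fin d) ℂ) : hs B Finset.univ = lhaf B := by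
  simp [hs, lhaf]

theorem hs_empty (B : Matrix (Fin d) (Fin d) ℂ) : hs B ∅ = 1 := by
  have : (Finset.univ.filter
      (fun σ : Equiv.Perm (Fin d) => σ * σ = 1 ∧ ∀ i, i ∉ (∅ : Finset (Fin d)) → σ i = i)) = {1} := by
    ext σ
    simp only [Finset.mem_filter, Finset.mem_univ, true_and, Finset.mem_singleton]
    constructor
    · rintro ⟨_, h⟩
      ext i; simp [h i]
    · rintro rfl; simp
  rw [hs, this]; simp

theorem hs_insert (B : Matrix (Fin d) (Fin d) ℂ) (s : Finset (Fin d)) (a : Fin d)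
    (ha : ∀ x ∈ s, a < x) :
    hs B (insert a s) = B a a * hs B s + ∑ j ∈ s, B a j * hs B (s.erase j) := by
  have has : a ∉ s := fun h => lt_irrefl _ (ha a h)
  have hinv : ∀ σ : Equiv.Perm (Fin d), σ * σ = 1 ↔ ∀ x, σ (σ x) = x := by
    intro σ
    rw [Equiv.ext_iff]; rfl
  rw [hs, ← Finset.sum_fiberwise_of_maps_to (s := Finset.univ.filter _) (t := insert a s)
    (g := fun σ : Equiv.Perm (Fin d) => σ a)]
  · rw [Finset.sum_insert has]
    congr 1
    · rw [hs, Finset.mul_sum]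
      apply Finset.sum_congr
      · ext σ
        simp only [Finset.mem_filter, Finset.mem_univ, true_and, Finset.mem_insert, not_or]
        constructor
        · rintro ⟨⟨h1, h2⟩, h3⟩
          refine ⟨h1, fun i hi => ?_⟩
          by_cases h : i = a
          · rw [h, h3]
          · exact h2 i ⟨h, hi⟩
        · rintro ⟨h1, h2⟩
          exact ⟨⟨h1, fun i hi => h2 i hi.2⟩, h2 a has⟩
      · intro σ hσ
        simp only [Finset.mem_filter, Finset.mem_univ, true_and] at hσ
        have h3 := hσ.2 a has
        rw [Finset.filter_insert, if_pos (by rw [h3]), Finset.prod_insert (by simp [has]), h3]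
    · apply Finset.sum_congr rfl
      intro j hj
      have haj : a < j := ha j hj
      rw [hs, Finset.mul_sum]
      have key : ∀ σ : Equiv.Perm (Fin d), ∀ x, x ≠ a → x ≠ j → (σ * Equiv.swap a j) x = σ x := by
        intro σ x h1 h2
        rw [Equiv.Perm.mul_apply, Equiv.swap_apply_of_ne_of_ne h1 h2]
      have keya : ∀ σ : Equiv.Perm (Fin d), (σ * Equiv.swap a j) a = σ j := by
        intro σ; simp
      have keyj : ∀ σ : Equiv.Perm (Fin d), (σ * Equiv.swap a j) j = σ a := by
        intro σ; simp
      refine Finset.sum_nbij' (fun σ => σ * Equiv.swap a j) (fun σ => σ * Equiv.swap a j) ?_ ?_ ?_ ?_ ?_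
      · intro σ hσ
        simp only [Finset.mem_filter, Finset.mem_univ, true_and, Finset.mem_insert, not_or, hinv] at hσ
        obtain ⟨⟨h1, h2⟩, h3⟩ := hσ
        have h4 : σ j = a := by rw [← h3, h1]
        simp only [Finset.mem_filter, Finset.mem_univ, true_and, hinv]
        constructor
        · intro x
          by_cases hx : x = a
          · subst hx; rw [keya, h4, keya, h4]
          · by_cases hx' : x = j
            · subst hx'; rw [keyj, h3, keyj, h3]
            · rw [key σ x hx hx', key, h1]
              · intro h; apply hx'; rw [← h1 x, h, h3]
              · intro h; apply hx; rw [← h1 x, h, h4]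
        · intro i hi
          by_cases hx : i = a
          · subst hx; rw [keya, h4]
          · by_cases hx' : i = j
            · subst hx'; rw [keyj, h3]
            · rw [key σ i hx hx']
              apply h2
              refine ⟨hx, fun h => hi (Finset.mem_erase.mpr ⟨hx', h⟩)⟩
      · intro σ hσ
        simp only [Finset.mem_filter, Finset.mem_univ, true_and, hinv] at hσ
        obtain ⟨h1, h2⟩ := hσ
        have h3 : σ a = a := h2 a (by simp [has])
        have h4 : σ j = j := h2 j (by simp)
        simp only [Finset.mem_filter, Finset.mem_univ, true_and, Finset.mem_insert, not_or, hinv]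
        refine ⟨⟨?_, ?_⟩, ?_⟩
        · intro x
          by_cases hx : x = a
          · subst hx; rw [keya, h4, keyj, h3]
          · by_cases hx' : x = j
            · subst hx'; rw [keyj, h3, keya, h4]
            · rw [key σ x hx hx', key, h1]
              · intro h; apply hx; rw [← h1 x, h, h3]
              · intro h; apply hx'; rw [← h1 x, h, h4]
        · rintro i ⟨hi, hi'⟩
          have : i ≠ j := fun h => hi' (h ▸ hj)
          rw [key σ i hi this]
          apply h2
          simp [hi']
        · rw [keya, h4]
      · intro σ _; rw [mul_assoc, Equiv.swap_mul_self, mul_one]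
      · intro σ _; rw [mul_assoc, Equiv.swap_mul_self, mul_one]
      · intro σ hσ
        simp only [Finset.mem_filter, Finset.mem_univ, true_and, Finset.mem_insert, not_or, hinv] at hσ
        obtain ⟨⟨h1, h2⟩, h3⟩ := hσ
        have h4 : σ j = a := by rw [← h3, h1]
        rw [Finset.filter_insert, if_pos (by rw [h3]; exact haj.le),
          Finset.prod_insert (by simp [has]), h3]
        congr 1
        apply Finset.prod_congr
        · ext i
          simp only [Finset.mem_filter, Finset.mem_erase]
          constructor
          · rintro ⟨hi, hle⟩
            have hij : i ≠ j := by
              rintro rfl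
              rw [h4] at hle
              exact absurd hle (not_le.mpr haj)
            rw [key σ i (fun h => has (h ▸ hi)) hij]
            exact ⟨⟨hij, hi⟩, hle⟩
          · rintro ⟨⟨hij, hi⟩, hle⟩
            rw [key σ i (fun h => has (h ▸ hi)) hij] at hle
            exact ⟨hi, hle⟩
        · intro i hi
          simp only [Finset.mem_filter, Finset.mem_erase] at hi
          rw [key σ i (fun h => has (h ▸ hi.1.2)) hi.1.1]
  · intro σ hσ
    simp only [Finset.mem_filter, Finset.mem_univ, true_and, Finset.mem_insert, not_or, hinv] at hσ
    by_contra h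
    simp only [Finset.mem_insert, not_or] at h
    have h5 := hσ.2 (σ a) h
    rw [hσ.1] at h5
    exact h.1 h5.symm

theorem hs_eq_E {κ : Type} [Fintype κ] [DecidableEq κ] (A : Matrix κ κ ℂ) (γ : κ → ℂ)
    (E : MvPolynomial κ ℂ →ₗ[ℂ] ℂ) (hE1 : E 1 = 1)
    (hE : ∀ i p,
      E (MvPolynomial.X i * p) = γ i * E p + ∑ j, A i j * E (MvPolynomial.pderiv j p))
    (f : Fin d → κ) (s : Finset (Fin d)) :
    hs (filldiag (A.submatrix f f) (γ ∘ f)) s = E (∏ i ∈ s, MvPolynomial.X (f i)) := by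
  have hder : ∀ (k : κ) (s : Finset (Fin d)),
      MvPolynomial.pderiv k (∏ i ∈ s, (MvPolynomial.X (f i) : MvPolynomial κ ℂ))
      = ∑ i ∈ s, (if f i = k then ∏ l ∈ s.erase i, MvPolynomial.X (f l) else 0) := by
    intro k s
    induction s using Finset.induction_on with
    | empty => simp
    | insert a s ha ih =>
      rw [Finset.prod_insert ha, Derivation.leibniz, ih, Finset.sum_insert ha,
        Finset.erase_insert ha, add_comm]
      congr 1
      · rw [MvPolynomial.pderiv_X]
        by_cases h : f a = k
        · subst h; simp
        · simp [h]
      · rw [smul_eq_mul, Finset.mul_sum]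
        refine Finset.sum_congr rfl fun i hi => ?_
        have hne : a ≠ i := fun h => ha (h ▸ hi)
        rw [Finset.erase_insert_of_ne hne, Finset.prod_insert (by simp [ha]), mul_ite, mul_zero]
  induction s using Finset.strongInduction with
  | _ s ih =>
  rcases s.eq_empty_or_nonempty with rfl | hne
  · simp [hs_empty, hE1]
  · set a := s.min' hne
    set t := s.erase a with ht
    have hat : a ∉ t := Finset.notMem_erase _ _
    have hst : s = insert a t := (Finset.insert_erase (s.min'_mem hne)).symm
    have hts : t ⊂ s := Finset.erase_ssubset (s.min'_mem hne)
    have hlt : ∀ x ∈ t, a < x := fun x hx =>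
      lt_of_le_of_ne (s.min'_le x (Finset.mem_of_mem_erase hx)) (Finset.ne_of_mem_erase hx).symm
    rw [hst, hs_insert _ _ _ hlt, Finset.prod_insert hat, hE, ih t hts]
    congr 1
    · simp [filldiag]
    · simp only [hder, map_sum, Finset.mul_sum]
      rw [Finset.sum_comm]
      refine Finset.sum_congr rfl fun j hj => ?_
      rw [Finset.sum_eq_single (f j), if_pos rfl,
        ih _ (lt_of_le_of_lt (Finset.erase_subset _ _) hts)]
      · have : a ≠ j := (hlt j hj).ne
        simp [filldiag, this]
      · intro k _ hk
        rw [if_neg (Ne.symm hk)]; simp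
      · simp

end Comb


theorem prod_rep {M : ℕ} (n : Fin M → ℕ) {R : Type} [CommRing R] (g : Fin M → R) :
    ∏ i, g (rep n i) = ∏ k, g k ^ n k := by
  have h1 : ∏ i, g (rep n i) = ((repList n).map g).prod := by
    rw [← Fin.prod_univ_getElem, ← Fintype.prod_equiv (finCongr (by simp [repList_length] : ((repList n).map g).length = ∑ k, n k))]
    intro i
    simp [rep]
  rw [h1, repList, List.map_flatMap, List.flatMap, List.prod_flatten, List.map_map, Fin.prod_univ_def]
  congr 1
  simp [Function.comp_def]

theorem prod_dbl {M : ℕ} (n : Fin M → ℕ) {R : Type} [CommRing R] (g : Fin M ⊕ Fin M → R) :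
    ∏ i, g (dbl n n i) = ∏ k, (g (Sum.inl k) * g (Sum.inr k)) ^ n k := by
  rw [← Fintype.prod_equiv finSumFinEquiv (fun x => g (Sum.map (rep n) (rep n) x))]
  · rw [Fintype.prod_sum_type]
    simp only [Sum.map_inl, Sum.map_inr, mul_pow, Finset.prod_mul_distrib]
    rw [prod_rep n (fun k => g (Sum.inl k)), prod_rep n (fun k => g (Sum.inr k))]
  · intro x; simp [dbl]

theorem lhs_reduce {M L : ℕ} (A : Matrix (Fin M ⊕ Fin M) (Fin M ⊕ Fin M) ℂ)
    (γ : Fin M ⊕ Fin M → ℂ) (π : Fin M → Fin L) (w : Fin L → ℂ) (N : ℕ) :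
    ∑ b ∈ (Fintype.piFinset fun _ : Fin L => Finset.range (N + 1)).filter
        (fun b => ∑ j, b j = N),
      lhafB π A γ b * ∏ j, w j ^ b j / (b j).factorial
    = ∑ n ∈ Finset.piAntidiag (Finset.univ : Finset (Fin M)) N,
      lhafv (repMat A n n) (repVec γ n n) / (∏ i, ((n i).factorial : ℂ)) * ∏ i, w (π i) ^ n i := by
  have hsum : ∀ n : Fin M → ℕ, ∑ j, ∑ i ∈ Finset.univ.filter (fun i => π i = j), n i = ∑ i, n i := by
    intro n
    exact Finset.sum_fiberwise _ _ _
  symm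
  rw [← Finset.sum_fiberwise_of_maps_to
    (t := (Fintype.piFinset fun _ : Fin L => Finset.range (N + 1)).filter (fun b => ∑ j, b j = N))
    (g := fun n j => ∑ i ∈ Finset.univ.filter (fun i => π i = j), n i)]
  · apply Finset.sum_congr rfl
    intro b hb
    have hbN := (Finset.mem_filter.mp hb).2
    have hset : (Finset.piAntidiag (Finset.univ : Finset (Fin M)) N).filter
        (fun n => (fun j => ∑ i ∈ Finset.univ.filter (fun i => π i = j), n i) = b) = Kset π b := by
      ext n
      simp only [Kset, Finset.mem_filter, Finset.mem_piAntidiag, Fintype.mem_piFinset, funext_iff,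
        Finset.mem_range]
      constructor
      · rintro ⟨⟨h1, _⟩, h2⟩
        refine ⟨fun i => ?_, h2⟩
        rw [hbN, ← h1]
        exact Nat.lt_succ_of_le (Finset.single_le_sum (f := n) (fun _ _ => Nat.zero_le _) (Finset.mem_univ i))
      · rintro ⟨_, h2⟩
        refine ⟨⟨?_, by simp⟩, h2⟩
        rw [← hsum, ← hbN]
        exact Finset.sum_congr rfl fun j _ => h2 j
    rw [hset, lhafB, Finset.prod_div_distrib]
    have hne : (∏ j, ((b j).factorial : ℂ)) ≠ 0 :=
      Finset.prod_ne_zero_iff.mpr fun j _ => by exact_mod_cast (b j).factorial_ne_zero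
    rw [mul_right_comm, mul_div_cancel₀ _ hne, mul_comm, Finset.sum_mul]
    apply Finset.sum_congr rfl
    intro n hn
    congr 1
    have h2 := (Finset.mem_filter.mp hn).2
    rw [← Finset.prod_fiberwise (s := Finset.univ) (g := π)]
    apply Finset.prod_congr rfl
    intro j _
    rw [← h2 j, ← Finset.prod_pow_eq_pow_sum]
    apply Finset.prod_congr rfl
    intro i hi
    rw [(Finset.mem_filter.mp hi).2]
  · intro n hn
    have h1 := (Finset.mem_piAntidiag.mp hn).1
    rw [Finset.mem_filter, Fintype.mem_piFinset]
    have h3 : ∑ j, ∑ i ∈ Finset.univ.filter (fun i => π i = j), n i = N := by rw [hsum, h1]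
    refine ⟨fun j => ?_, h3⟩
    rw [Finset.mem_range, ← h3]
    exact Nat.lt_succ_of_le (Finset.single_le_sum (f := fun j => ∑ i ∈ Finset.univ.filter (fun i => π i = j), n i) (fun _ _ => Nat.zero_le _) (Finset.mem_univ j))


theorem aux5 {κ : Type} [Fintype κ] [DecidableEq κ] (A S : Matrix κ κ ℂ) (hA : A.IsSymm)
    (hS : S.IsSymm) (γ : κ → ℂ) (E : MvPolynomial κ ℂ →ₗ[ℂ] ℂ)
    (hE : ∀ i p,
      E (MvPolynomial.X i * p) = γ i * E p + ∑ j, A i j * E (MvPolynomial.pderiv j p))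
    (e : ℕ → MvPolynomial κ ℂ) (he0 : ∀ j, MvPolynomial.pderiv j (e 0) = 0)
    (he : ∀ j m, MvPolynomial.pderiv j (e (m + 1)) = ∑ l, S j l • (MvPolynomial.X l * e m))
    (m : ℕ) :
    ∑ i, ∑ j, S i j * E (MvPolynomial.X i * (MvPolynomial.X j * e m))
      = ∑ r ∈ Finset.range (m + 1), (Matrix.trace ((S * A) ^ (r + 1))
          + ((r : ℂ) + 1) * (γ ⬝ᵥ (((S * A) ^ r * S) *ᵥ γ))) * E (e (m - r)) := by
  -- linear terms
  have hSA : ∀ v : κ → ℂ, ∀ l, ((S * A) *ᵥ v) l = ∑ i, ∑ j, v i * (A i j * S j l) := by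
    intro v l
    rw [← Matrix.mulVec_mulVec]
    simp only [Matrix.mulVec, dotProduct, Finset.mul_sum]
    rw [Finset.sum_comm]
    refine Finset.sum_congr rfl fun i _ => Finset.sum_congr rfl fun j _ => ?_
    rw [hA.apply i j, hS.apply l j]
    ring
  have L1 : ∀ m (v : κ → ℂ), ∑ i, v i * E (MvPolynomial.X i * e m)
      = ∑ k ∈ Finset.range (m + 1), (γ ⬝ᵥ ((S * A) ^ k *ᵥ v)) * E (e (m - k)) := by
    intro m
    induction m with
    | zero =>
      intro v
      simp only [hE, he0, map_zero, mul_zero, Finset.sum_const_zero, add_zero]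
      simp only [zero_add, Finset.range_one, Finset.sum_singleton, pow_zero, Matrix.one_mulVec,
        dotProduct, Finset.sum_mul]
      exact Finset.sum_congr rfl fun i _ => by ring
    | succ m ih =>
      intro v
      rw [Finset.sum_range_succ']
      have hps : ∀ k, (S * A) ^ (k + 1) *ᵥ v = (S * A) ^ k *ᵥ ((S * A) *ᵥ v) := by
        intro k; rw [Matrix.mulVec_mulVec, pow_succ]
      simp only [hps, Nat.add_sub_add_right]
      rw [← ih ((S * A) *ᵥ v)]
      simp only [hE _ (e (m+1)), he, map_sum, map_smul, smul_eq_mul, hSA, mul_add,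
        Finset.sum_add_distrib]
      rw [add_comm]
      congr 1
      · simp only [Finset.sum_mul, Finset.mul_sum]
        rw [Finset.sum_comm_cycle]
        refine Finset.sum_congr rfl fun i _ => Finset.sum_congr rfl fun j _ => Finset.sum_congr rfl fun l _ => ?_
        ring
      · simp only [pow_zero, Matrix.one_mulVec, dotProduct, Finset.sum_mul, Nat.sub_zero]
        exact Finset.sum_congr rfl fun i _ => by ring
  have hSAB : ∀ B : Matrix κ κ ℂ, ∀ l j, (S * A * B) l j = ∑ i, ∑ k, B i j * (A i k * S k l) := by
    intro B l j
    exact hSA (fun i => B i j) l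
  have hder : ∀ i j m, E (MvPolynomial.X i * (MvPolynomial.X j * e m)) =
      γ i * E (MvPolynomial.X j * e m) + (A i j * E (e m)
        + ∑ k, A i k * E (MvPolynomial.X j * MvPolynomial.pderiv k (e m))) := by
    intro i j m
    rw [hE]
    congr 1
    simp only [Derivation.leibniz, map_add, smul_eq_mul, MvPolynomial.pderiv_X, mul_add,
      Finset.sum_add_distrib]
    rw [add_comm]
    congr 1
    rw [Finset.sum_eq_single j]
    · simp
    · intro k _ hk
      rw [Pi.single_eq_of_ne (Ne.symm hk)]; simp
    · simp
  have htr : ∀ (B : Matrix κ κ ℂ), ∑ i, ∑ j, B i j * A i j = Matrix.trace (B * A) := by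
    intro B
    simp only [Matrix.trace, Matrix.diag, Matrix.mul_apply]
    refine Finset.sum_congr rfl fun i _ => Finset.sum_congr rfl fun j _ => ?_
    rw [hA.apply i j]
  have hlin : ∀ (B : Matrix κ κ ℂ) m, ∑ i, ∑ j, B i j * (γ i * E (MvPolynomial.X j * e m))
      = ∑ j, (Bᵀ *ᵥ γ) j * E (MvPolynomial.X j * e m) := by
    intro B m
    rw [Finset.sum_comm]
    refine Finset.sum_congr rfl fun j _ => ?_
    simp only [Matrix.mulVec, dotProduct, Finset.sum_mul, Matrix.transpose_apply]
    refine Finset.sum_congr rfl fun i _ => ?_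
    ring
  have L2 : ∀ m (B : Matrix κ κ ℂ), ∑ i, ∑ j, B i j * E (MvPolynomial.X i * (MvPolynomial.X j * e m))
      = ∑ k ∈ Finset.range (m + 1), (Matrix.trace ((S * A) ^ k * B * A) * E (e (m - k))
        + ∑ j, ((((S * A) ^ k * B)ᵀ) *ᵥ γ) j * E (MvPolynomial.X j * e (m - k))) := by
    intro m
    induction m with
    | zero =>
      intro B
      simp only [hder, he0, map_zero, mul_zero, Finset.sum_const_zero, add_zero, mul_add,
        Finset.sum_add_distrib, hlin]
      rw [add_comm]
      simp [← htr, Finset.sum_mul, mul_assoc]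
    | succ m ih =>
      intro B
      rw [Finset.sum_range_succ']
      simp only [pow_succ, Nat.add_sub_add_right, mul_assoc _ (S * A) B]
      rw [← ih (S * A * B)]
      simp only [hder _ _ (m+1), he, mul_add, Finset.sum_add_distrib, hlin]
      rw [add_comm, add_comm (∑ i, ∑ j, B i j * (A i j * _)), add_assoc]
      congr 1
      · simp only [hSAB, Finset.mul_sum, Finset.sum_mul, map_sum, mul_smul_comm, map_smul, smul_eq_mul]
        rw [Finset.sum_comm (f := fun l j => ∑ i, ∑ k, B i j * (A i k * S k l) * _)]
        rw [Finset.sum_comm]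
        refine Finset.sum_congr rfl fun j _ => ?_
        rw [Finset.sum_comm_cycle]
        refine Finset.sum_congr rfl fun l _ => Finset.sum_congr rfl fun i _ => Finset.sum_congr rfl fun k _ => ?_
        rw [mul_left_comm (MvPolynomial.X l)]
        ring
      · simp [← htr, Finset.sum_mul, mul_assoc]
  have hpow : ∀ k, ((S * A) ^ k * S)ᵀ = (S * A) ^ k * S := by
    intro k
    induction k with
    | zero => simpa using hS.eq
    | succ k ih =>
      rw [pow_succ', mul_assoc, Matrix.transpose_mul, ih, Matrix.transpose_mul, hS.eq, hA.eq]
      rw [← mul_assoc (S * A), ← pow_succ', pow_succ]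
      simp only [mul_assoc]
  rw [L2 m S]
  simp only [hpow, L1, add_mul (Matrix.trace _) _ _, Finset.sum_add_distrib, Matrix.mulVec_mulVec, ← mul_assoc, ← pow_add]
  congr 1
  · refine Finset.sum_congr rfl fun k _ => ?_
    rw [pow_succ, mul_assoc]
  · have := Finset.sum_range_diag_flip (m + 1) (fun k l => (γ ⬝ᵥ (((S * A) ^ (l + k) * S) *ᵥ γ)) * E (e (m - (k + l))))
    have h2 : ∀ k ∈ Finset.range (m + 1), ∑ l ∈ Finset.range (m - k + 1), (γ ⬝ᵥ (((S * A) ^ (l + k) * S) *ᵥ γ)) * E (e (m - k - l)) =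
      ∑ l ∈ Finset.range (m + 1 - k), (γ ⬝ᵥ (((S * A) ^ (l + k) * S) *ᵥ γ)) * E (e (m - (k + l))) := by
      intro k hk
      have hk' := Finset.mem_range.mp hk
      rw [show m - k + 1 = m + 1 - k by omega]
      simp only [Nat.sub_sub]
    rw [Finset.sum_congr rfl h2, ← this]
    refine Finset.sum_congr rfl fun r _ => ?_
    rw [Finset.sum_congr rfl (g := fun _ => (γ ⬝ᵥ (((S * A) ^ r * S) *ᵥ γ)) * E (e (m - r)))]
    · simp; ring
    · intro k hk
      have hk' := Finset.mem_range.mp hk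
      rw [show r - k + k = r by omega, show k + (r - k) = r by omega]


open Polynomial in
theorem aux6 (a F : ℕ → ℂ) (h0 : F 0 = 1)
    (hF : ∀ m : ℕ, ((m : ℂ) + 1) * F (m + 1)
      = ∑ r ∈ Finset.range (m + 1), ((r : ℂ) + 1) * a (r + 1) * F (m - r)) :
    ∀ n J K : ℕ, n ≤ J → n ≤ K →
      Polynomial.coeff (∑ j ∈ Finset.range (J + 1),
        Polynomial.C (Ring.inverse ((j.factorial : ℕ) : ℂ)) *
        (∑ k ∈ Finset.Icc 1 K, Polynomial.C (a k) * Polynomial.X ^ k) ^ j) n = F n := by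
  intro n
  induction n using Nat.strong_induction_on with
  | _ n ih =>
  intro J K hJ hK
  cases n with
  | zero =>
    rw [h0, Polynomial.coeff_zero_eq_eval_zero, Polynomial.eval_finsetSum,
      Finset.sum_eq_single 0]
    · simp
    · intro j _ hj
      have : Polynomial.eval 0 (∑ k ∈ Finset.Icc 1 K, Polynomial.C (a k) * Polynomial.X ^ k) = 0 := by
        rw [Polynomial.eval_finsetSum]
        apply Finset.sum_eq_zero
        intro k hk
        have : k ≠ 0 := by have := (Finset.mem_Icc.mp hk).1; omega
        simp [this]
      rw [Polynomial.eval_mul, Polynomial.eval_pow, this]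
      simp [hj]
    · simp
  | succ n =>
    obtain ⟨J, rfl⟩ : ∃ J', J = J' + 1 := ⟨J - 1, by omega⟩
    set G : ℂ[X] := ∑ k ∈ Finset.Icc 1 K, Polynomial.C (a k) * Polynomial.X ^ k with hG
    have hGc : ∀ k, k + 1 ≤ K → G.coeff (k + 1) = a (k + 1) := by
      intro k hk
      rw [hG, Polynomial.finsetSum_coeff]
      simp only [Polynomial.coeff_C_mul_X_pow]
      rw [Finset.sum_ite_eq]
      simp [hk]
    have hd : Polynomial.derivative (∑ j ∈ Finset.range (J + 1 + 1),
        Polynomial.C (Ring.inverse ((j.factorial : ℕ) : ℂ)) * G ^ j)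
        = Polynomial.derivative G * ∑ j ∈ Finset.range (J + 1),
        Polynomial.C (Ring.inverse ((j.factorial : ℕ) : ℂ)) * G ^ j := by
      rw [Finset.sum_range_succ', Polynomial.derivative_add, Polynomial.derivative_sum,
        Finset.mul_sum]
      simp only [pow_zero, mul_one, Polynomial.derivative_C, add_zero]
      apply Finset.sum_congr rfl
      intro j _
      rw [Polynomial.derivative_C_mul, Polynomial.derivative_pow]
      have : (Polynomial.C (Ring.inverse (((j+1).factorial : ℕ) : ℂ)) : ℂ[X]) *
        Polynomial.C (((j + 1 : ℕ) : ℂ)) = Polynomial.C (Ring.inverse ((j.factorial : ℕ) : ℂ)) := by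
        rw [← Polynomial.C_mul]
        congr 1
        have h1 : ((j.factorial : ℕ) : ℂ) ≠ 0 := by exact_mod_cast j.factorial_ne_zero
        have h2 : ((j : ℂ) + 1) ≠ 0 := by exact_mod_cast j.succ_ne_zero
        rw [Nat.factorial_succ]
        simp only [Ring.inverse_eq_inv']
        push_cast
        field_simp
      simp only [Nat.add_sub_cancel]
      rw [← this]
      ring
    have hc := congrArg (fun p => Polynomial.coeff p n) hd
    simp only [Polynomial.coeff_derivative] at hc
    have hne : ((n : ℂ) + 1) ≠ 0 := by exact_mod_cast n.succ_ne_zero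
    apply mul_left_cancel₀ hne
    rw [mul_comm, hc, hF, Polynomial.coeff_mul, Finset.Nat.sum_antidiagonal_eq_sum_range_succ_mk]
    apply Finset.sum_congr rfl
    intro r hr
    have hr' := Finset.mem_range.mp hr
    rw [ih (n - r) (by omega) J K (by omega) (by omega), Polynomial.coeff_derivative,
      hGc r (by omega)]
    ring


theorem DX_eq {M : ℕ} (z : Fin M → ℂ) : Dmat z * Xmat (Fin M) ℂ
    = Matrix.fromBlocks 0 (Matrix.diagonal z) (Matrix.diagonal z) 0 := by
  have : Dmat z = Matrix.fromBlocks (Matrix.diagonal z) 0 0 (Matrix.diagonal z) := by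
    rw [Dmat, Matrix.fromBlocks_diagonal]
  rw [this, Xmat, Matrix.fromBlocks_multiply]
  simp

def qpoly {M : ℕ} (z : Fin M → ℂ) : MvPolynomial (Fin M ⊕ Fin M) ℂ :=
  ∑ i, z i • (MvPolynomial.X (Sum.inl i) * MvPolynomial.X (Sum.inr i))

theorem pderiv_qpoly {M : ℕ} (z : Fin M → ℂ) (j : Fin M ⊕ Fin M) :
    MvPolynomial.pderiv j (qpoly z)
      = ∑ l, (Dmat z * Xmat (Fin M) ℂ) j l • MvPolynomial.X l := by
  rw [DX_eq, qpoly, map_sum]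
  simp only [Derivation.map_smul, Derivation.leibniz, smul_eq_mul, MvPolynomial.pderiv_X,
    Fintype.sum_sum_type]
  rcases j with j | j
  · simp [Matrix.diagonal_apply, Pi.single_apply, ite_smul]
  · simp [Matrix.diagonal_apply, Pi.single_apply, ite_smul]

theorem qpoly_quad {M : ℕ} (z : Fin M → ℂ) (p : MvPolynomial (Fin M ⊕ Fin M) ℂ)
    (E : MvPolynomial (Fin M ⊕ Fin M) ℂ →ₗ[ℂ] ℂ) :
    ∑ i, ∑ j, (Dmat z * Xmat (Fin M) ℂ) i j * E (MvPolynomial.X i * (MvPolynomial.X j * p))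
      = 2 * E (qpoly z * p) := by
  rw [DX_eq, qpoly, Finset.sum_mul, map_sum]
  simp only [Fintype.sum_sum_type, Matrix.fromBlocks_apply₁₁, Matrix.fromBlocks_apply₁₂,
    Matrix.fromBlocks_apply₂₁, Matrix.fromBlocks_apply₂₂, Matrix.zero_apply, zero_mul,
    Finset.sum_const_zero, zero_add, add_zero, Matrix.diagonal_apply, ite_mul, Finset.sum_ite_eq,
    Finset.mem_univ, if_true]
  rw [two_mul, ← Finset.sum_add_distrib, ← Finset.sum_add_distrib]
  refine Finset.sum_congr rfl fun i _ => ?_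
  rw [smul_mul_assoc, map_smul, smul_eq_mul, mul_left_comm (MvPolynomial.X (Sum.inr i)), mul_assoc]

theorem qpoly_pow {M : ℕ} (z : Fin M → ℂ) (N : ℕ) :
    ((N.factorial : ℂ)⁻¹) • (qpoly z) ^ N
      = ∑ n ∈ Finset.piAntidiag (Finset.univ : Finset (Fin M)) N,
        ((∏ i, ((n i).factorial : ℂ))⁻¹ * ∏ i, z i ^ n i) •
          ∏ i, (MvPolynomial.X (Sum.inl i) * MvPolynomial.X (Sum.inr i)) ^ n i := by
  rw [qpoly, Finset.sum_pow_eq_sum_piAntidiag, Finset.smul_sum]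
  refine Finset.sum_congr rfl fun n hn => ?_
  have h1 := (Finset.mem_piAntidiag.mp hn).1
  have hm := Nat.multinomial_spec Finset.univ n
  rw [h1] at hm
  have hmC : (∏ i, ((n i).factorial : ℂ)) * (Nat.multinomial Finset.univ n : ℂ) = (N.factorial : ℂ) := by
    rw [← hm]; push_cast; rfl
  have hne : (∏ j, ((n j).factorial : ℂ)) ≠ 0 :=
    Finset.prod_ne_zero_iff.mpr fun j _ => by exact_mod_cast (n j).factorial_ne_zero
  have hN : (N.factorial : ℂ) ≠ 0 := by exact_mod_cast N.factorial_ne_zero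
  simp only [smul_pow, Finset.prod_smul]
  rw [← nsmul_eq_mul, ← Nat.cast_smul_eq_nsmul ℂ, smul_smul, smul_smul]
  congr 2
  rw [← hmC] at hN ⊢
  have := right_ne_zero_of_mul hN
  field_simp


/-- Blocked loop Hafnian master theorem: for a set partition of `{1,…,M}` given by the
fibers of the surjection `π : Fin M → Fin L`, and `z̄_i = w_{π(i)}`,
`Σ_{b ∈ ℕ^L, Σ b = N} lhaf_Λ(A,γ,b) · Π_j w_j^{b_j}/b_j! = f_N(A, γ, z̄)`. -/
theorem blocked_lhaf_master (M L : ℕ) (hM : 1 ≤ M)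
    (A : Matrix (Fin M ⊕ Fin M) (Fin M ⊕ Fin M) ℂ) (hA : A.IsSymm)
    (γ : Fin M ⊕ Fin M → ℂ) (π : Fin M → Fin L) (hπ : Function.Surjective π)
    (w : Fin L → ℂ) (N : ℕ) :
    ∑ b ∈ (Fintype.piFinset fun _ : Fin L => Finset.range (N + 1)).filter
        (fun b => ∑ j, b j = N),
      lhafB π A γ b * ∏ j, w j ^ b j / (b j).factorial
      = fN N A γ (fun i => w (π i)) := by
  obtain ⟨E, hE1, hE⟩ := stein_exists A hA γ
  set z : Fin M → ℂ := fun i => w (π i) with hz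
  set S := Dmat z * Xmat (Fin M) ℂ with hS
  have hSsymm : S.IsSymm := by
    rw [hS, DX_eq]
    exact Matrix.IsSymm.fromBlocks (by simp) (by simp) (by simp)
  let e : ℕ → MvPolynomial (Fin M ⊕ Fin M) ℂ := fun m => ((m.factorial : ℂ)⁻¹) • (qpoly z) ^ m
  have he0 : ∀ j, MvPolynomial.pderiv j (e 0) = 0 := by
    intro j; simp [e]
  have hfac : ∀ m : ℕ, (((m + 1).factorial : ℂ)⁻¹) * ((m : ℂ) + 1) = (m.factorial : ℂ)⁻¹ := by
    intro m
    have h1 : ((m.factorial : ℕ) : ℂ) ≠ 0 := by exact_mod_cast m.factorial_ne_zero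
    have h2 : ((m : ℂ) + 1) ≠ 0 := by exact_mod_cast m.succ_ne_zero
    rw [Nat.factorial_succ]
    push_cast
    field_simp
  have he : ∀ j m, MvPolynomial.pderiv j (e (m + 1))
      = ∑ l, S j l • (MvPolynomial.X l * e m) := by
    intro j m
    simp only [e, Derivation.map_smul, Derivation.leibniz_pow, pderiv_qpoly, Nat.add_sub_cancel]
    rw [← Nat.cast_smul_eq_nsmul ℂ, smul_smul]
    push_cast
    rw [hfac, smul_eq_mul, Finset.mul_sum, Finset.smul_sum]
    refine Finset.sum_congr rfl fun l _ => ?_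
    rw [mul_smul_comm, mul_smul_comm, smul_comm, mul_comm]
  have hqe : ∀ m : ℕ, qpoly z * e m = ((m : ℂ) + 1) • e (m + 1) := by
    intro m
    simp only [e]
    rw [smul_smul, mul_comm ((m : ℂ) + 1), hfac, mul_smul_comm, pow_succ']
  have hrec : ∀ m : ℕ, ((m : ℂ) + 1) * E (e (m + 1))
      = ∑ r ∈ Finset.range (m + 1), ((r : ℂ) + 1) * gfun A γ z (r + 1) * E (e (m - r)) := by
    intro m
    have h5 := aux5 A S hA hSsymm γ E hE e he0 he m
    rw [hS, qpoly_quad, hqe, map_smul, smul_eq_mul, ← hS] at h5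
    apply mul_left_cancel₀ (two_ne_zero (α := ℂ))
    rw [h5, Finset.mul_sum]
    refine Finset.sum_congr rfl fun r _ => ?_
    have h2 : ((r : ℂ) + 1) ≠ 0 := by exact_mod_cast r.succ_ne_zero
    rw [gfun, ← hS]
    simp only [Ring.inverse_eq_inv', Nat.add_sub_cancel]
    push_cast
    field_simp
  have h0 : E (e 0) = 1 := by simp [e, hE1]
  rw [fN, aux6 (gfun A γ z) (fun m => E (e m)) h0 hrec N N N le_rfl le_rfl, lhs_reduce]
  simp only [e]
  rw [qpoly_pow, map_sum]
  refine Finset.sum_congr rfl fun n _ => ?_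
  rw [lhafv, ← hs_univ, repMat, repVec, hs_eq_E A γ E hE1 hE (dbl n n) Finset.univ,
    prod_dbl n (fun k => (MvPolynomial.X k : MvPolynomial (Fin M ⊕ Fin M) ℂ)), map_smul, smul_eq_mul]
  ring

end
end

section
/- (Off-diagonal embedding.) Let M ≥ 1, let A ∈ ℂ^{2M×2M} be symmetric, let γ ∈ ℂ^{2M}, and let n, m ∈ ℕ^M. Set T := Σ_{k=1}^M (n_k + m_k) and d := Σ_{k=1}^M |n_k − m_k| (T and d have the same parity). Let r := d/2 if T is even, and r := (d+1)/2 if T is odd, and set M' := M + r. Define t ∈ ℕ^{M'} by t_k = min(n_k, m_k) for 1 ≤ k ≤ M and t_k = 1 for M < k ≤ M'. Then there exist a symmetric matrix A' ∈ ℂ^{2M'×2M'}, a vector γ' ∈ ℂ^{2M'}, and a T×T permutation matrix P such that: if T is even, P·A_{n⊕m}·P^T = A'_{t⊕t} and P·γ_{n⊕m} = γ'_{t⊕t}; and if T is odd, (P·A_{n⊕m}·P^T) ⊕ (1) = A'_{t⊕t} and (P·γ_{n⊕m}) ⊕ (1) = γ'_{t⊕t}. In either case lhaf(A_{n⊕m},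 γ_{n⊕m}) = lhaf(A'_{t⊕t}, γ'_{t⊕t}). -/
open Matrix

noncomputable section

/-- The permutation matrix of a permutation `σ`. -/
def permMat {d : ℕ} (σ : Equiv.Perm (Fin d)) : Matrix (Fin d) (Fin d) ℂ :=
  Matrix.of fun i j => if σ j = i then 1 else 0

/-- `B ⊕ (1)`: append one extra row and column with diagonal entry `1` and zero
off-diagonal entries. -/
def extendOne {T : ℕ} (B : Matrix (Fin T) (Fin T) ℂ) : Matrix (Fin (T + 1)) (Fin (T + 1)) ℂ :=
  Matrix.reindex finSumFinEquiv finSumFinEquiv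
    (Matrix.fromBlocks B 0 0 (1 : Matrix (Fin 1) (Fin 1) ℂ))

/-- `v ⊕ (1)`: append the entry `1` to a vector. -/
def extendOneVec {T : ℕ} (v : Fin T → ℂ) : Fin (T + 1) → ℂ :=
  Sum.elim v (fun _ => 1) ∘ finSumFinEquiv.symm

/-- `d = Σ_k |n_k − m_k|`. -/
def dOf {M : ℕ} (n m : Fin M → ℕ) : ℕ :=
  ∑ k, (max (n k) (m k) - min (n k) (m k))

/-- `r = d/2` if `T = Σ_k (n_k + m_k)` is even, `r = (d+1)/2` if `T` is odd. -/
def rOf {M : ℕ} (n m : Fin M → ℕ) : ℕ :=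
  if ((∑ k, n k) + (∑ k, m k)) % 2 = 0 then dOf n m / 2 else (dOf n m + 1) / 2

/-- The pattern `t ∈ ℕ^{M+r}` with `t_k = min(n_k, m_k)` for `k < M` and `t_k = 1` for the
`r` added modes. -/
def tOf {M : ℕ} (n m : Fin M → ℕ) : Fin (M + rOf n m) → ℕ :=
  fun k => if h : (k : ℕ) < M then min (n ⟨k, h⟩) (m ⟨k, h⟩) else 1

lemma permMat_mul_apply {d : ℕ} (σ : Equiv.Perm (Fin d)) (B : Matrix (Fin d) (Fin d) ℂ) :
    permMat σ * B * (permMat σ)ᵀ = B.submatrix σ.symm σ.symm := by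
  ext i j
  simp [permMat, Matrix.mul_apply, ← Equiv.eq_symm_apply]

lemma permMat_mulVec {d : ℕ} (σ : Equiv.Perm (Fin d)) (v : Fin d → ℂ) :
    (permMat σ).mulVec v = v ∘ σ.symm := by
  ext i
  simp [permMat, Matrix.mulVec, dotProduct, ← Equiv.eq_symm_apply]

lemma lhaf_submatrix {d : ℕ} (B : Matrix (Fin d) (Fin d) ℂ) (hB : B.IsSymm)
    (e : Equiv.Perm (Fin d)) : lhaf (B.submatrix e e) = lhaf B := by
  unfold lhaf
  refine Finset.sum_bij' (fun σ _ => e * σ * e⁻¹) (fun σ _ => e⁻¹ * σ * e) ?_ ?_ ?_ ?_ ?_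
  · intro σ hσ
    simp only [Finset.mem_filter, Finset.mem_univ, true_and] at hσ ⊢
    calc e * σ * e⁻¹ * (e * σ * e⁻¹) = e * (σ * σ) * e⁻¹ := by group
      _ = 1 := by rw [hσ]; group
  · intro σ hσ
    simp only [Finset.mem_filter, Finset.mem_univ, true_and] at hσ ⊢
    calc e⁻¹ * σ * e * (e⁻¹ * σ * e) = e⁻¹ * (σ * σ) * e := by group
      _ = 1 := by rw [hσ]; group
  · intro σ _; group
  · intro σ _; group
  · intro σ hσ
    simp only [Finset.mem_filter, Finset.mem_univ, true_and] at hσ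
    have hs : ∀ i, σ (σ i) = i := fun i => by
      have := congrArg (fun τ : Equiv.Perm (Fin d) => τ i) hσ
      simpa using this
    refine Finset.prod_bij' (fun i _ => if e i ≤ e (σ i) then e i else e (σ i))
      (fun j _ => if e.symm j ≤ σ (e.symm j) then e.symm j else σ (e.symm j)) ?_ ?_ ?_ ?_ ?_
    · intro i hi
      simp only [Finset.mem_filter, Finset.mem_univ, true_and] at hi ⊢
      split_ifs with h
      · simpa using h
      · simpa [hs] using (not_le.mp h).le
    · intro j hj
      simp only [Finset.mem_filter, Finset.mem_univ, true_and] at hj ⊢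
      split_ifs with h
      · simpa using h
      · simpa [hs] using (not_le.mp h).le
    · intro i hi
      simp only [Finset.mem_filter, Finset.mem_univ, true_and] at hi
      by_cases h : e i ≤ e (σ i)
      · simp [h, hi]
      · simp only [h, if_false, Equiv.symm_apply_apply, hs]
        split_ifs with h2
        · have h3 := le_antisymm hi h2
          rw [← h3]
        · rfl
    · intro j hj
      simp only [Finset.mem_filter, Finset.mem_univ, true_and] at hj
      simp only [Equiv.Perm.coe_mul, Function.comp_apply, Equiv.Perm.inv_def] at hj
      by_cases h : e.symm j ≤ σ (e.symm j)
      · simp [h, hj]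
      · simp only [h, if_false, Equiv.apply_symm_apply, hs]
        split_ifs with h2
        · exact le_antisymm h2 hj
        · rfl
    · intro i hi
      split_ifs with h
      · simp
      · simp [hs, hB.apply]

lemma filldiag_isSymm {d : ℕ} (A : Matrix (Fin d) (Fin d) ℂ) (hA : A.IsSymm) (γ : Fin d → ℂ) :
    (filldiag A γ).IsSymm := by
  ext i j
  by_cases h : i = j
  · subst h; simp [filldiag]
  · simp [filldiag, h, Ne.symm h, hA.apply]

lemma lhafv_submatrix {d : ℕ} (A : Matrix (Fin d) (Fin d) ℂ) (hA : A.IsSymm) (γ : Fin d → ℂ)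
    (e : Equiv.Perm (Fin d)) : lhafv (A.submatrix e e) (γ ∘ e) = lhafv A γ := by
  unfold lhafv
  rw [← lhaf_submatrix _ (filldiag_isSymm A hA γ) e]
  congr 1
  ext i j
  simp [filldiag]

lemma lhafv_cast {d d' : ℕ} (h : d = d') (A : Matrix (Fin d) (Fin d) ℂ) (γ : Fin d → ℂ) :
    lhafv (Matrix.reindex (finCongr h) (finCongr h) A) (γ ∘ (finCongr h).symm) = lhafv A γ := by
  subst h
  rfl

lemma extendOne_cc {T : ℕ} (B : Matrix (Fin T) (Fin T) ℂ) (i j : Fin T) :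
    extendOne B i.castSucc j.castSucc = B i j := by
  have h : ∀ i : Fin T, finSumFinEquiv.symm (i.castSucc) = Sum.inl (β := Fin 1) i := fun i =>
    finSumFinEquiv_symm_apply_castAdd i
  simp [extendOne, h]

lemma extendOne_cl {T : ℕ} (B : Matrix (Fin T) (Fin T) ℂ) (i : Fin T) :
    extendOne B i.castSucc (Fin.last T) = 0 := by
  have h : ∀ i : Fin T, finSumFinEquiv.symm (i.castSucc) = Sum.inl (β := Fin 1) i := fun i =>
    finSumFinEquiv_symm_apply_castAdd i
  have hlst : finSumFinEquiv.symm (Fin.last T) = Sum.inr (α := Fin T) (0 : Fin 1) :=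
    finSumFinEquiv_symm_apply_natAdd 0
  simp [extendOne, h, hlst]

lemma extendOne_lc {T : ℕ} (B : Matrix (Fin T) (Fin T) ℂ) (i : Fin T) :
    extendOne B (Fin.last T) i.castSucc = 0 := by
  have h : ∀ i : Fin T, finSumFinEquiv.symm (i.castSucc) = Sum.inl (β := Fin 1) i := fun i =>
    finSumFinEquiv_symm_apply_castAdd i
  have hlst : finSumFinEquiv.symm (Fin.last T) = Sum.inr (α := Fin T) (0 : Fin 1) :=
    finSumFinEquiv_symm_apply_natAdd 0
  simp [extendOne, h, hlst]

lemma extendOne_ll {T : ℕ} (B : Matrix (Fin T) (Fin T) ℂ) :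
    extendOne B (Fin.last T) (Fin.last T) = 1 := by
  have hlst : finSumFinEquiv.symm (Fin.last T) = Sum.inr (α := Fin T) (0 : Fin 1) :=
    finSumFinEquiv_symm_apply_natAdd 0
  simp [extendOne, hlst]

lemma extendOneVec_c {T : ℕ} (v : Fin T → ℂ) (i : Fin T) :
    extendOneVec v i.castSucc = v i := by
  have h : finSumFinEquiv.symm (i.castSucc) = Sum.inl (β := Fin 1) i :=
    finSumFinEquiv_symm_apply_castAdd i
  simp [extendOneVec, h]

lemma extendOneVec_l {T : ℕ} (v : Fin T → ℂ) : extendOneVec v (Fin.last T) = 1 := by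
  have hlst : finSumFinEquiv.symm (Fin.last T) = Sum.inr (α := Fin T) (0 : Fin 1) :=
    finSumFinEquiv_symm_apply_natAdd 0
  simp [extendOneVec, hlst]

/-- Extend a permutation of `Fin T` by fixing the last element of `Fin (T + 1)`. -/
def extPerm {T : ℕ} (τ : Equiv.Perm (Fin T)) : Equiv.Perm (Fin (T + 1)) :=
  finSumFinEquiv.permCongr (Equiv.Perm.sumCongr τ (1 : Equiv.Perm (Fin 1)))

lemma extPerm_c {T : ℕ} (τ : Equiv.Perm (Fin T)) (i : Fin T) :
    extPerm τ i.castSucc = (τ i).castSucc := by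
  have h : finSumFinEquiv.symm (i.castSucc) = Sum.inl (β := Fin 1) i :=
    finSumFinEquiv_symm_apply_castAdd i
  simp [extPerm, h]
  rfl

lemma extPerm_l {T : ℕ} (τ : Equiv.Perm (Fin T)) : extPerm τ (Fin.last T) = Fin.last T := by
  have hlst : finSumFinEquiv.symm (Fin.last T) = Sum.inr (α := Fin T) (0 : Fin 1) :=
    finSumFinEquiv_symm_apply_natAdd 0
  simp only [extPerm, Equiv.permCongr_apply, hlst]
  rfl

lemma extPerm_surj {T : ℕ} (σ : Equiv.Perm (Fin (T + 1))) (h : σ (Fin.last T) = Fin.last T) :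
    ∃ τ, extPerm τ = σ := by
  have key : ∀ (σ : Equiv.Perm (Fin (T + 1))), σ (Fin.last T) = Fin.last T →
      ∀ i : Fin T, σ i.castSucc ≠ Fin.last T := by
    intro σ h i hi
    rw [← h] at hi
    exact (Fin.castSucc_lt_last i).ne (σ.injective hi)
  have h2 : σ⁻¹ (Fin.last T) = Fin.last T := by
    rw [Equiv.Perm.inv_eq_iff_eq]; exact h.symm
  refine ⟨⟨fun i => (σ i.castSucc).castPred (key σ h i),
    fun i => (σ⁻¹ i.castSucc).castPred (key _ h2 i), ?_, ?_⟩, ?_⟩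
  · intro i; simp
  · intro i; simp
  · ext i
    refine Fin.lastCases ?_ (fun i => ?_) i
    · rw [extPerm_l, h]
    · rw [extPerm_c]; simp

lemma lhaf_extendOne {T : ℕ} (C : Matrix (Fin T) (Fin T) ℂ) : lhaf (extendOne C) = lhaf C := by
  unfold lhaf
  symm
  refine Finset.sum_of_injOn extPerm ?_ ?_ ?_ ?_
  · intro a _ b _ hab
    ext i
    have := congrArg (fun τ : Equiv.Perm (Fin (T + 1)) => τ i.castSucc) hab
    simp only [extPerm_c] at this
    rw [Fin.castSucc_injective _ this]
  · intro τ hτ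
    simp only [Finset.coe_filter, Finset.mem_univ, true_and, Set.mem_ofPred_eq] at hτ ⊢
    ext i
    refine Fin.lastCases ?_ (fun i => ?_) i
    · simp [extPerm_l]
    · have := congrArg (fun τ : Equiv.Perm (Fin T) => τ i) hτ
      simp only [Equiv.Perm.coe_mul, Function.comp_apply, Equiv.Perm.coe_one, id] at this
      simp [extPerm_c, this]
  · intro σ hσ hn
    simp only [Finset.mem_filter, Finset.mem_univ, true_and] at hσ
    have hs : ∀ i, σ (σ i) = i := fun i => by
      have := congrArg (fun τ : Equiv.Perm (Fin (T + 1)) => τ i) hσ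
      simpa using this
    have hl : σ (Fin.last T) ≠ Fin.last T := by
      intro hl
      obtain ⟨τ, rfl⟩ := extPerm_surj σ hl
      refine hn ⟨τ, ?_, rfl⟩
      simp only [Finset.coe_filter, Finset.mem_univ, true_and, Set.mem_ofPred_eq]
      ext i
      have := hs i.castSucc
      simp only [extPerm_c] at this
      simpa using congrArg Fin.val this
    refine Finset.prod_eq_zero (i := σ (Fin.last T)) ?_ ?_
    · simp [hs, Fin.le_last]
    · rw [hs]
      obtain ⟨j, hj⟩ := Fin.exists_castSucc_eq.mpr hl
      rw [← hj, extendOne_cl]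
  · intro τ _
    rw [Finset.prod_filter, Finset.prod_filter, Fin.prod_univ_castSucc]
    simp [extPerm_c, extPerm_l, extendOne_cc, extendOne_ll]

lemma lhafv_extendOne {T : ℕ} (B : Matrix (Fin T) (Fin T) ℂ) (v : Fin T → ℂ) :
    lhafv (extendOne B) (extendOneVec v) = lhafv B v := by
  unfold lhafv
  rw [← lhaf_extendOne (filldiag B v)]
  congr 1
  ext i j
  refine Fin.lastCases ?_ (fun i => ?_) i <;> refine Fin.lastCases ?_ (fun j => ?_) j
  · simp [filldiag, extendOne_ll, extendOneVec_l]
  · simp [filldiag, extendOne_lc, (Fin.castSucc_lt_last j).ne']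
  · simp [filldiag, extendOne_cl, (Fin.castSucc_lt_last i).ne]
  · simp [filldiag, extendOne_cc, extendOneVec_c]

lemma sum_rep {M : ℕ} (n : Fin M → ℕ) (w : Fin M → ℕ) :
    ∑ i, w (rep n i) = ∑ k, n k * w k := by
  have h1 : ∑ i, w (rep n i) = ((repList n).map w).sum := by
    rw [← Fin.sum_univ_fun_getElem]
    exact Fintype.sum_equiv (finCongr (repList_length n).symm) _ _ (fun i => rfl)
  rw [h1, repList, Fin.sum_univ_def]
  induction List.finRange M with
  | nil => rfl
  | cons a l ih => simp [List.flatMap_cons, ih]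

lemma sum_dbl {M : ℕ} (n m : Fin M → ℕ) (w : Fin M ⊕ Fin M → ℕ) :
    ∑ i, w (dbl n m i) = ∑ k, n k * w (Sum.inl k) + ∑ k, m k * w (Sum.inr k) := by
  rw [← sum_rep n (fun k => w (Sum.inl k)), ← sum_rep m (fun k => w (Sum.inr k)),
    Fin.sum_univ_add]
  simp [dbl]

lemma repList_last {K : ℕ} (t : Fin K → ℕ) (x : Fin K) (hx : (x : ℕ) + 1 = K) (ht : t x = 1) :
    ∃ l, repList t = l ++ [x] := by
  cases K with
  | zero => exact x.elim0
  | succ K =>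
    have : x = Fin.last K := Fin.ext (by simpa using hx)
    subst this
    refine ⟨((List.finRange K).map Fin.castSucc).flatMap fun k => List.replicate (t k) k, ?_⟩
    rw [repList, List.finRange_succ_last, List.flatMap_append]
    simp only [List.flatMap_singleton, ht, List.replicate_one]

lemma rep_last {K : ℕ} (t : Fin K → ℕ) (x : Fin K) (hx : (x : ℕ) + 1 = K) (ht : t x = 1)
    (i : Fin (∑ k, t k)) (hi : (i : ℕ) + 1 = ∑ k, t k) : rep t i = x := by
  obtain ⟨l, hl⟩ := repList_last t x hx ht
  have hlen := repList_length t
  rw [hl] at hlen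
  simp only [List.length_append, List.length_singleton] at hlen
  unfold rep
  simp only [List.get_eq_getElem, hl, Fin.val_cast]
  rw [List.getElem_append_right (by omega)]
  simp

lemma exists_perm {T : ℕ} {X : Type*} [DecidableEq X] (F G : Fin T → X)
    (h : ∀ w : X → ℕ, ∑ i, w (F i) = ∑ i, w (G i)) :
    ∃ σ : Equiv.Perm (Fin T), ∀ i, G (σ i) = F i := by
  have hc : ∀ c, Fintype.card {a // F a = c} = Fintype.card {a // G a = c} := by
    intro c
    have := h (fun x => if x = c then 1 else 0)
    simpa [Fintype.card_subtype] using this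
  exact ⟨Equiv.ofFiberEquiv (fun c => Fintype.equivOfCardEq (hc c)),
    fun i => Equiv.ofFiberEquiv_map _ i⟩

/-- The labels of the added modes: the first `D` positions are labelled by `g`, others `none`. -/
def padFun {X : Type*} {D r : ℕ} (g : Fin D → X) (x : Fin r ⊕ Fin r) : Option X :=
  if h : (finSumFinEquiv x : ℕ) < D then some (g ⟨_, h⟩) else none

lemma sum_padFun {X : Type*} {D r e : ℕ} (g : Fin D → X) (h : r + r = D + e)
    (w : Option X → ℕ) :
    ∑ j : Fin r, w (padFun g (Sum.inl j)) + ∑ j : Fin r, w (padFun g (Sum.inr j))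
      = ∑ i, w (some (g i)) + e * w none := by
  have h1 : ∀ N, N = D + e →
      ∑ i : Fin N, w (if h : (i : ℕ) < D then some (g ⟨_, h⟩) else none)
      = ∑ i, w (some (g i)) + e * w none := by
    rintro N rfl
    rw [Fin.sum_univ_add]
    simp
  rw [← h1 _ h, Fin.sum_univ_add]
  simp [padFun]
  rfl

/-- The label of each mode of the embedded system. -/
def labelFun {M D r : ℕ} (g : Fin D → Fin M ⊕ Fin M) :
    Fin (M + r) ⊕ Fin (M + r) → Option (Fin M ⊕ Fin M) :=
  Sum.elim
    (Fin.addCases (fun k => some (Sum.inl k)) (fun j => padFun g (Sum.inl j)))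
    (Fin.addCases (fun k => some (Sum.inr k)) (fun j => padFun g (Sum.inr j)))

/-- The leftover labels. -/
def leftFun {M : ℕ} (n m : Fin M → ℕ) := dbl (fun k => n k - m k) (fun k => m k - n k)

lemma dOf_eq {M : ℕ} (n m : Fin M → ℕ) :
    ∑ k, (n k - m k) + ∑ k, (m k - n k) = dOf n m := by
  rw [dOf, ← Finset.sum_add_distrib]
  refine Finset.sum_congr rfl (fun k _ => ?_)
  omega

lemma T_eq {M : ℕ} (n m : Fin M → ℕ) :
    ∑ k, n k + ∑ k, m k = 2 * ∑ k, min (n k) (m k) + dOf n m := by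
  rw [dOf, ← Finset.sum_add_distrib, Finset.mul_sum, ← Finset.sum_add_distrib]
  refine Finset.sum_congr rfl (fun k _ => ?_)
  omega

lemma tOf_castAdd {M : ℕ} (n m : Fin M → ℕ) (k : Fin M) :
    tOf n m (Fin.castAdd _ k) = min (n k) (m k) := by
  simp [tOf]

lemma tOf_natAdd {M : ℕ} (n m : Fin M → ℕ) (k : Fin (rOf n m)) :
    tOf n m (Fin.natAdd _ k) = 1 := by
  simp [tOf]

lemma sum_tOf {M : ℕ} (n m : Fin M → ℕ) :
    ∑ k, tOf n m k = ∑ k, min (n k) (m k) + rOf n m := by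
  rw [Fin.sum_univ_add]
  simp [tOf_castAdd, tOf_natAdd]

lemma sum_label {M e : ℕ} (n m : Fin M → ℕ) (he : rOf n m + rOf n m = dOf n m + e)
    (w : Option (Fin M ⊕ Fin M) → ℕ) :
    ∑ i, w (labelFun (leftFun n m) (dbl (tOf n m) (tOf n m) i))
      = ∑ i, w (some (dbl n m i)) + e * w none := by
  rw [sum_dbl (tOf n m) (tOf n m) (fun x => w (labelFun (leftFun n m) x)),
    sum_dbl n m (fun x => w (some x)), Fin.sum_univ_add, Fin.sum_univ_add]
  have h := sum_padFun (leftFun n m) (r := rOf n m) (e := e) (by rw [dOf_eq]; exact he) w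
  unfold leftFun at h
  rw [sum_dbl _ _ (fun x => w (some x))] at h
  simp only [tOf_castAdd, tOf_natAdd, labelFun, Sum.elim_inl, Sum.elim_inr, Fin.addCases_left,
    Fin.addCases_right, one_mul]
  have e1 : ∑ k, n k * w (some (Sum.inl k)) = ∑ k, min (n k) (m k) * w (some (Sum.inl k))
      + ∑ k, (n k - m k) * w (some (Sum.inl k)) := by
    rw [← Finset.sum_add_distrib]
    refine Finset.sum_congr rfl (fun k _ => ?_)
    rw [← add_mul]; congr 1; omega
  have e2 : ∑ k, m k * w (some (Sum.inr k)) = ∑ k, min (n k) (m k) * w (some (Sum.inr k))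
      + ∑ k, (m k - n k) * w (some (Sum.inr k)) := by
    rw [← Finset.sum_add_distrib]
    refine Finset.sum_congr rfl (fun k _ => ?_)
    rw [← add_mul]; congr 1; omega
  rw [e1, e2]
  unfold leftFun
  omega

/-- Entries of the embedded matrix in terms of labels. -/
def entry {X : Type*} (A : Matrix X X ℂ) : Option X → Option X → ℂ
  | some a, some b => A a b
  | none, none => 1
  | _, _ => 0

/-- Entries of the embedded vector in terms of labels. -/
def entryVec {X : Type*} (γ : X → ℂ) : Option X → ℂ
  | some a => γ a
  | none => 1

lemma label_last {M : ℕ} (n m : Fin M → ℕ) (he : rOf n m + rOf n m = dOf n m + 1)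
    (i : Fin (∑ k, tOf n m k + ∑ k, tOf n m k))
    (hi : (i : ℕ) + 1 = ∑ k, tOf n m k + ∑ k, tOf n m k) :
    labelFun (leftFun n m) (dbl (tOf n m) (tOf n m) i) = none := by
  have hr : 0 < rOf n m := by omega
  have hs := sum_tOf n m
  let j : Fin (rOf n m) := ⟨rOf n m - 1, by omega⟩
  let i' : Fin (∑ k, tOf n m k) := ⟨∑ k, tOf n m k - 1, by omega⟩
  have hi' : i = Fin.natAdd _ i' := Fin.ext (by simp [i']; omega)
  have hrep : rep (tOf n m) i' = Fin.natAdd M j :=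
    rep_last _ _ (by simp [j]; omega) (tOf_natAdd n m j) _ (by simp [i']; omega)
  have hd : dbl (tOf n m) (tOf n m) i = Sum.inr (Fin.natAdd M j) := by
    rw [hi']
    rw [dbl, Function.comp_apply, finSumFinEquiv_symm_apply_natAdd, Sum.map_inr, hrep]
  rw [hd]
  have hD := dOf_eq n m
  simp only [labelFun, Sum.elim_inr, Fin.addCases_right, padFun]
  rw [dif_neg]
  simp [j]
  omega

/-- Off-diagonal embedding: for patterns `n, m ∈ ℕ^M` there are a symmetric matrix `A'` of
size `2M' × 2M'` (with `M' = M + r`), a vector `γ'`, and a `T × T` permutation matrix `P`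
such that, if `T` is even, `P·A_{n⊕m}·Pᵀ = A'_{t⊕t}` and `P·γ_{n⊕m} = γ'_{t⊕t}`, while if
`T` is odd, `(P·A_{n⊕m}·Pᵀ) ⊕ (1) = A'_{t⊕t}` and `(P·γ_{n⊕m}) ⊕ (1) = γ'_{t⊕t}`; in
either case `lhaf(A_{n⊕m}, γ_{n⊕m}) = lhaf(A'_{t⊕t}, γ'_{t⊕t})`. -/
theorem off_diagonal_embedding (M : ℕ) (hM : 1 ≤ M)
    (A : Matrix (Fin M ⊕ Fin M) (Fin M ⊕ Fin M) ℂ) (hA : A.IsSymm)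
    (γ : Fin M ⊕ Fin M → ℂ) (n m : Fin M → ℕ) :
    ∃ (A' : Matrix (Fin (M + rOf n m) ⊕ Fin (M + rOf n m))
              (Fin (M + rOf n m) ⊕ Fin (M + rOf n m)) ℂ)
      (γ' : Fin (M + rOf n m) ⊕ Fin (M + rOf n m) → ℂ)
      (σ : Equiv.Perm (Fin ((∑ k, n k) + (∑ k, m k)))),
      A'.IsSymm ∧
      (((∑ k, n k) + (∑ k, m k)) % 2 = 0 →
        ∃ h : (∑ k, tOf n m k) + (∑ k, tOf n m k) = (∑ k, n k) + (∑ k, m k),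
          permMat σ * repMat A n m * (permMat σ)ᵀ
            = Matrix.reindex (finCongr h) (finCongr h) (repMat A' (tOf n m) (tOf n m)) ∧
          (permMat σ).mulVec (repVec γ n m)
            = repVec γ' (tOf n m) (tOf n m) ∘ (finCongr h).symm) ∧
      (((∑ k, n k) + (∑ k, m k)) % 2 = 1 →
        ∃ h : (∑ k, tOf n m k) + (∑ k, tOf n m k) = ((∑ k, n k) + (∑ k, m k)) + 1,
          extendOne (permMat σ * repMat A n m * (permMat σ)ᵀ)
            = Matrix.reindex (finCongr h) (finCongr h) (repMat A' (tOf n m) (tOf n m)) ∧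
          extendOneVec ((permMat σ).mulVec (repVec γ n m))
            = repVec γ' (tOf n m) (tOf n m) ∘ (finCongr h).symm) ∧
      lhafv (repMat A n m) (repVec γ n m)
        = lhafv (repMat A' (tOf n m) (tOf n m)) (repVec γ' (tOf n m) (tOf n m)) := by
  have hT := T_eq n m
  have hs := sum_tOf n m
  have hsym : (Matrix.of fun x y => entry A (labelFun (leftFun n m) x)
      (labelFun (leftFun n m) y) :
      Matrix (Fin (M + rOf n m) ⊕ Fin (M + rOf n m)) _ ℂ).IsSymm := by
    ext x y
    simp only [Matrix.transpose_apply, Matrix.of_apply]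
    rcases labelFun (leftFun n m) x with _ | a <;> rcases labelFun (leftFun n m) y with _ | b <;>
      simp [entry, hA.apply]
  have hsymR : (repMat A n m).IsSymm := by
    ext x y
    simp [repMat, hA.apply]
  rcases Nat.mod_two_eq_zero_or_one ((∑ k, n k) + (∑ k, m k)) with hp | hp
  · have he : rOf n m + rOf n m = dOf n m + 0 := by
      have : rOf n m = dOf n m / 2 := by rw [rOf, if_pos hp]
      omega
    have h : (∑ k, tOf n m k) + (∑ k, tOf n m k) = (∑ k, n k) + (∑ k, m k) := by omega
    obtain ⟨σ, hσ⟩ := exists_perm (fun i => some (dbl n m i))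
      (fun i => labelFun (leftFun n m) (dbl (tOf n m) (tOf n m) ((finCongr h).symm i))) (by
        intro w
        have h1 := sum_label n m he w
        rw [zero_mul, add_zero] at h1
        rw [← h1]
        exact Fintype.sum_equiv (finCongr h) _ _ (fun i => by simp))
    have hσ' : ∀ i, labelFun (leftFun n m) (dbl (tOf n m) (tOf n m) ((finCongr h).symm i))
        = some (dbl n m (σ.symm i)) := fun i => by
      rw [← hσ]; simp
    refine ⟨Matrix.of fun x y => entry A (labelFun (leftFun n m) x) (labelFun (leftFun n m) y),
      fun x => entryVec γ (labelFun (leftFun n m) x), σ, hsym, ?_⟩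
    have c1 : permMat σ * repMat A n m * (permMat σ)ᵀ
        = Matrix.reindex (finCongr h) (finCongr h) (repMat (Matrix.of fun x y =>
            entry A (labelFun (leftFun n m) x) (labelFun (leftFun n m) y))
            (tOf n m) (tOf n m)) := by
      rw [permMat_mul_apply]
      ext i j
      simp only [Matrix.reindex_apply, Matrix.submatrix_apply, repMat, Matrix.of_apply, hσ', entry]
    have c2 : (permMat σ).mulVec (repVec γ n m)
        = repVec (fun x => entryVec γ (labelFun (leftFun n m) x)) (tOf n m) (tOf n m)
          ∘ (finCongr h).symm := by
      rw [permMat_mulVec]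
      ext i
      simp only [repVec, Function.comp_apply, hσ', entryVec]
    refine ⟨fun _ => ⟨h, c1, c2⟩, fun hp' => by omega, ?_⟩
    rw [← lhafv_cast h, ← c1, ← c2, permMat_mul_apply, permMat_mulVec, lhafv_submatrix _ hsymR]
  · have he : rOf n m + rOf n m = dOf n m + 1 := by
      have : rOf n m = (dOf n m + 1) / 2 := by rw [rOf, if_neg (by omega)]
      omega
    have h : (∑ k, tOf n m k) + (∑ k, tOf n m k) = (∑ k, n k) + (∑ k, m k) + 1 := by omega
    have hl : labelFun (leftFun n m) (dbl (tOf n m) (tOf n m)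
        ((finCongr h).symm (Fin.last _))) = none :=
      label_last n m he _ (by simp [h])
    obtain ⟨σ, hσ⟩ := exists_perm (fun i => some (dbl n m i))
      (fun i => labelFun (leftFun n m)
        (dbl (tOf n m) (tOf n m) ((finCongr h).symm i.castSucc))) (by
        intro w
        have h1 := sum_label n m he w
        have h2 : ∑ i, w (labelFun (leftFun n m) (dbl (tOf n m) (tOf n m) i))
            = ∑ i, w (labelFun (leftFun n m)
              (dbl (tOf n m) (tOf n m) ((finCongr h).symm i))) :=
          Fintype.sum_equiv (finCongr h) _ _ (fun i => by simp)
        rw [h2, Fin.sum_univ_castSucc, hl, one_mul] at h1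
        exact (Nat.add_right_cancel h1).symm)
    have hσ' : ∀ i, labelFun (leftFun n m)
        (dbl (tOf n m) (tOf n m) ((finCongr h).symm (Fin.castSucc i)))
        = some (dbl n m (σ.symm i)) := fun i => by
      rw [← hσ, Equiv.apply_symm_apply]
    refine ⟨Matrix.of fun x y => entry A (labelFun (leftFun n m) x) (labelFun (leftFun n m) y),
      fun x => entryVec γ (labelFun (leftFun n m) x), σ, hsym, ?_⟩
    have c1 : extendOne (permMat σ * repMat A n m * (permMat σ)ᵀ)
        = Matrix.reindex (finCongr h) (finCongr h) (repMat (Matrix.of fun x y =>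
            entry A (labelFun (leftFun n m) x) (labelFun (leftFun n m) y))
            (tOf n m) (tOf n m)) := by
      rw [permMat_mul_apply]
      ext i j
      refine Fin.lastCases ?_ (fun i => ?_) i <;> refine Fin.lastCases ?_ (fun j => ?_) j <;>
      simp only [Matrix.reindex_apply, Matrix.submatrix_apply, repMat, Matrix.of_apply, hσ', entry,
        hl, extendOne_ll, extendOne_lc, extendOne_cl, extendOne_cc]
    have c2 : extendOneVec ((permMat σ).mulVec (repVec γ n m))
        = repVec (fun x => entryVec γ (labelFun (leftFun n m) x)) (tOf n m) (tOf n m)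
          ∘ (finCongr h).symm := by
      rw [permMat_mulVec]
      ext i
      refine Fin.lastCases ?_ (fun i => ?_) i <;>
      simp only [repVec, Function.comp_apply, hσ', entryVec, hl, extendOneVec_l, extendOneVec_c]
    refine ⟨fun hp' => by omega, fun _ => ⟨h, c1, c2⟩, ?_⟩
    rw [← lhafv_cast h, ← c1, ← c2, lhafv_extendOne, permMat_mul_apply, permMat_mulVec,
      lhafv_submatrix _ hsymR]

end
end
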